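/- There exist a prefix-closed gizmo G and a traversal sequence C such that the postselection G^C is not prefix-closed. Concretely, let G be the gizmo on locations {a,b,c,d} accepted by the two-state automaton with both states accepting, where state 1 allows exactly the traversal a→b (leading to state 2), state 2 allows exactly the traversal c→d (leading back to state 1), and trivial traversals ℓ→ℓ are allowed in every state without changing state. Then G is a prefix-closed gizmo, and for C = [c→d], the sequence [a→b] belongs to G^C while its prefix, the empty sequence, does not; hence G^C is not prefix-closed. -/

import Mathlib

/-- A traversal sequence on a location type `L`: a finite list of traversals `a → b`. -/
abbrev TravSeq (L : Type*) := List (L × L)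

/-- A gizmo on `L`: a set of traversal sequences closed under inserting trivial
traversals and contracting consecutive composable traversals. -/
def IsGizmo {L : Type*} (G : Set (TravSeq L)) : Prop :=
  (∀ (X Y : TravSeq L) (a : L), X ++ Y ∈ G → X ++ [(a, a)] ++ Y ∈ G) ∧
  (∀ (X Y : TravSeq L) (a b c : L), X ++ [(a, b), (b, c)] ++ Y ∈ G → X ++ [(a, c)] ++ Y ∈ G)

/-- A set of traversal sequences is prefix-closed if `X ++ Y ∈ G` implies `X ∈ G`. -/
def PrefixClosed {L : Type*} (G : Set (TravSeq L)) : Prop :=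
  ∀ X Y : TravSeq L, X ++ Y ∈ G → X ∈ G

/-- The four locations `a, b, c, d` of the symmetric self-closing door. -/
inductive Loc4 | a | b | c | d
deriving DecidableEq

open Loc4

/-- The canonical alternating sequence `[a→b, c→d, a→b, c→d, …]` of length `n`. -/
def altSeq : ℕ → TravSeq Loc4
  | 0 => []
  | n + 1 => altSeq n ++ [if n % 2 = 0 then (a, b) else (c, d)]

/-- The gizmo `G` of the symmetric self-closing door with both states accepting:
every traversal is `a→b`, `c→d`, or a trivial traversal `ℓ→ℓ`, and the subsequence of
nontrivial traversals is an initial segment of the alternation `a→b, c→d, a→b, …`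
(state 1 allows exactly `a→b`, leading to state 2; state 2 allows exactly `c→d`,
leading back to state 1; trivial traversals are allowed everywhere). -/
def G4 : Set (TravSeq Loc4) :=
  {X | (∀ p ∈ X, p = (a, b) ∨ p = (c, d) ∨ p.1 = p.2) ∧
       ∃ n, X.filter (fun p => p.1 ≠ p.2) = altSeq n}

theorem length_altSeq (n : ℕ) : (altSeq n).length = n := by
  induction n with
  | zero => rfl
  | succ n ih => simp [altSeq, ih]

theorem exists_eq_altSeq_of_append_eq {U V : TravSeq Loc4} {n : ℕ} (h : U ++ V = altSeq n) :
    ∃ m, U = altSeq m := by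
  induction n generalizing V with
  | zero => exact ⟨0, (List.append_eq_nil_iff.mp h).1⟩
  | succ n ih =>
    rcases List.eq_nil_or_concat V with rfl | ⟨V', v, rfl⟩
    · exact ⟨n + 1, by simpa using h⟩
    · rw [altSeq, List.concat_eq_append, ← List.append_assoc] at h
      exact ih (List.append_inj' h rfl).1

theorem singleton_cd_ne_altSeq (n : ℕ) : [(c, d)] ≠ altSeq n := by
  intro h
  have hn : n = 1 := by simpa [length_altSeq] using (congrArg List.length h).symm
  subst hn
  simp [altSeq] at h

theorem prefixClosed_G4 : PrefixClosed G4 := by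
  rintro X Y ⟨hX, n, hn⟩
  rw [List.filter_append] at hn
  exact ⟨fun p hp => hX p (List.mem_append_left Y hp), exists_eq_altSeq_of_append_eq hn⟩

theorem isGizmo_G4 : IsGizmo G4 := by
  refine ⟨?_, ?_⟩
  · rintro X Y l ⟨hX, n, hn⟩
    refine ⟨fun p hp => ?_, n, by simpa using hn⟩
    simp only [List.mem_append, List.mem_singleton] at hp hX
    rcases hp with (hp | rfl) | hp
    · exact hX p (Or.inl hp)
    · exact Or.inr (Or.inr rfl)
    · exact hX p (Or.inr hp)
  · rintro X Y x y z ⟨hX, n, hn⟩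
    have h₁ := hX (x, y) (by simp)
    have h₂ := hX (y, z) (by simp)
    have hxyz : x = y ∨ y = z := by
      simp only [Prod.mk.injEq] at h₁ h₂
      rcases h₁ with ⟨rfl, rfl⟩ | ⟨rfl, rfl⟩ | h₁
      · simpa using h₂
      · simpa using h₂
      · exact Or.inl h₁
    refine ⟨fun p hp => ?_, n, ?_⟩
    · simp only [List.mem_append, List.mem_singleton] at hp
      rcases hp with (hp | rfl) | hp
      · exact hX p (by simp [hp])
      · rcases hxyz with rfl | rfl
        · exact h₂
        · exact h₁
      · exact hX p (by simp [hp])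
    · rw [← hn]
      rcases hxyz with rfl | rfl <;> simp [List.filter_cons]

/-- There exist a prefix-closed gizmo `G` and a traversal sequence `C`
such that the postselection `G^C` is not prefix-closed: for the symmetric self-closing
door `G4` and `C = [c→d]`, the gizmo `G4` is prefix-closed, `[a→b]` belongs to `G4^C`,
the empty sequence (a prefix of `[a→b]`) does not, and hence `G4^C` is not
prefix-closed. -/
theorem postselection_not_prefixClosed :
    IsGizmo G4 ∧ PrefixClosed G4 ∧
    [(a, b)] ∈ {X : TravSeq Loc4 | X ++ [(c, d)] ∈ G4} ∧
    ([] : TravSeq Loc4) ∉ {X : TravSeq Loc4 | X ++ [(c, d)] ∈ G4} ∧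
    ¬ PrefixClosed {X : TravSeq Loc4 | X ++ [(c, d)] ∈ G4} := by
  have hmem : [(a, b)] ∈ {X : TravSeq Loc4 | X ++ [(c, d)] ∈ G4} :=
    ⟨by simp, 2, by simp [altSeq]⟩
  have hnil : ([] : TravSeq Loc4) ∉ {X : TravSeq Loc4 | X ++ [(c, d)] ∈ G4} := by
    rintro ⟨-, n, hn⟩
    exact singleton_cd_ne_altSeq n (by simpa using hn)
  exact ⟨isGizmo_G4, prefixClosed_G4, hmem, hnil, fun h => hnil (h [] [(a, b)] hmem)⟩
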